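/- Let 13/14 < γ < 1 be fixed and ε > 0, let α be real and h a positive integer. Let N ≥ 2 and set M = N^{(16−15γ)/29} and ϑ = N^{(2γ+23)/58}. Let m be a positive integer with m ≤ M/2, let N₁ < N₂ ≤ 2N₁ with N₁ ≤ N/2, set f(d,l) = αhd²l² − m d^γ l^γ, and let c(d) be complex numbers with |c(d)| ≤ log d. Then Θ₂ = Σ_{d ≤ ϑ} c(d) Σ_{N₁/d < l ≤ N₂/d} e(f(d,l)) satisfies Θ₂ ≪ m^{1/6} ϑ^{1/2} N₁^{γ/6 + 1/2} N^ε, where the implied constant depends only on γ and ε. -/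

import Mathlib

/-- `e2pi x = e^{2πix}`. -/
noncomputable def e2pi (x : ℝ) : ℂ := Complex.exp (2 * Real.pi * Complex.I * x)

open Finset

lemma norm_e2pi (x : ℝ) : ‖e2pi x‖ = 1 := by
  have h : (2 * Real.pi * Complex.I * x : ℂ) = ((2 * Real.pi * x : ℝ) : ℂ) * Complex.I := by
    push_cast; ring
  rw [e2pi, h, Complex.norm_exp_ofReal_mul_I]

lemma e2pi_add (x y : ℝ) : e2pi (x + y) = e2pi x * e2pi y := by
  rw [e2pi, e2pi, e2pi, ← Complex.exp_add]
  congr 1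
  push_cast
  ring

lemma conj_e2pi (x : ℝ) : (starRingEnd ℂ) (e2pi x) = e2pi (-x) := by
  rw [e2pi, e2pi, ← Complex.exp_conj]
  congr 1
  simp [map_ofNat (starRingEnd ℂ) 2]

lemma e2pi_intCast (k : ℤ) : e2pi k = 1 := by
  rw [e2pi, Complex.exp_eq_one_iff]
  exact ⟨k, by push_cast; ring⟩

lemma e2pi_sub_intCast (x : ℝ) (k : ℤ) : e2pi (x - k) = e2pi x := by
  have h := e2pi_add (x - k) k
  rw [e2pi_intCast, mul_one, sub_add_cancel] at h
  exact h.symm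

lemma e2pi_eq_sq (x : ℝ) :
    e2pi x = ((Real.cos (Real.pi * x) : ℂ) + Real.sin (Real.pi * x) * Complex.I) ^ 2 := by
  rw [e2pi, Complex.ofReal_cos, Complex.ofReal_sin, ← Complex.exp_mul_I, ← Complex.exp_nat_mul]
  congr 1
  push_cast
  ring

/-- The value of `1 / (1 - e2pi x)`, written through the cotangent of `π x`. -/
noncomputable def cotWeight (x : ℝ) : ℂ :=
  1 / 2 + Complex.I / 2 * ((Real.cos (Real.pi * x) / Real.sin (Real.pi * x) : ℝ) : ℂ)

lemma one_sub_e2pi_mul_cotWeight {x : ℝ} (h : Real.sin (Real.pi * x) ≠ 0) :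
    (1 - e2pi x) * cotWeight x = 1 := by
  have hs : (Real.sin (Real.pi * x) : ℂ) ≠ 0 := by exact_mod_cast h
  have hcs : (Real.cos (Real.pi * x) : ℂ) ^ 2 + (Real.sin (Real.pi * x) : ℂ) ^ 2 = 1 := by
    exact_mod_cast Real.cos_sq_add_sin_sq (Real.pi * x)
  rw [e2pi_eq_sq, cotWeight, Complex.ofReal_div]
  generalize (Real.cos (Real.pi * x) : ℂ) = c at *
  generalize (Real.sin (Real.pi * x) : ℂ) = s at *
  field_simp
  have hI := Complex.I_sq
  generalize Complex.I = i at *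
  linear_combination (s - i * c) * hcs + (-s ^ 3 - 2 * c ^ 2 * s - c * s ^ 2 * i) * hI

lemma two_mul_le_sin_pi_mul {x δ : ℝ} (hδ : 0 < δ) (h1 : δ ≤ x) (h2 : x ≤ 1 - δ) :
    2 * δ ≤ Real.sin (Real.pi * x) := by
  have key : ∀ y : ℝ, 0 ≤ y → y ≤ 1 / 2 → 2 * y ≤ Real.sin (Real.pi * y) := by
    intro y hy0 hy1
    have := Real.mul_le_sin (x := Real.pi * y) (by positivity) (by nlinarith [Real.pi_pos])
    have h3 : 2 / Real.pi * (Real.pi * y) = 2 * y := by field_simp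
    linarith
  rcases le_total x (1 / 2) with h | h
  · linarith [key x (by linarith) h]
  · have h3 := key (1 - x) (by linarith) (by linarith)
    have h4 : Real.pi * (1 - x) = Real.pi - Real.pi * x := by ring
    rw [h4, Real.sin_pi_sub] at h3
    linarith

lemma norm_cotWeight_le {x δ : ℝ} (hδ : 0 < δ) (h1 : δ ≤ x) (h2 : x ≤ 1 - δ) :
    ‖cotWeight x‖ ≤ 1 / (4 * δ) := by
  have hs := two_mul_le_sin_pi_mul hδ h1 h2
  have hs0 : 0 < Real.sin (Real.pi * x) := by linarith
  have h := congrArg norm (one_sub_e2pi_mul_cotWeight hs0.ne')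
  have hcs : (Real.cos (Real.pi * x)) ^ 2 + (Real.sin (Real.pi * x)) ^ 2 = 1 :=
    Real.cos_sq_add_sin_sq (Real.pi * x)
  have hn : ‖1 - e2pi x‖ = 2 * Real.sin (Real.pi * x) := by
    rw [e2pi_eq_sq]
    generalize Real.cos (Real.pi * x) = c at *
    generalize Real.sin (Real.pi * x) = s at *
    have h5 : (1 : ℂ) - ((c : ℂ) + s * Complex.I) ^ 2 =
        ((2 * s : ℝ) : ℂ) * (s - c * Complex.I) := by
      have hcs' : (c : ℂ) ^ 2 + (s : ℂ) ^ 2 = 1 := by exact_mod_cast hcs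
      push_cast
      linear_combination -hcs' - (s : ℂ) ^ 2 * Complex.I_sq
    have h6 : ‖(s : ℂ) - c * Complex.I‖ = 1 := by
      have : (s : ℂ) - c * Complex.I = ((s : ℝ) : ℂ) + ((-c : ℝ) : ℂ) * Complex.I := by
        push_cast; ring
      rw [this, Complex.norm_add_mul_I, Real.sqrt_eq_one]
      linarith
    rw [h5, norm_mul, h6, mul_one, Complex.norm_real, Real.norm_of_nonneg (by linarith)]
  rw [norm_mul, hn, norm_one] at h
  rw [le_div_iff₀ (by positivity)]
  nlinarith [norm_nonneg (cotWeight x)]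

lemma norm_cotWeight_sub {x y : ℝ} (h0 : 0 < x) (hxy : x ≤ y) (h1 : y < 1) :
    ‖cotWeight y - cotWeight x‖ =
      (Real.cos (Real.pi * x) / Real.sin (Real.pi * x) -
        Real.cos (Real.pi * y) / Real.sin (Real.pi * y)) / 2 := by
  have hπ := Real.pi_pos
  have hsx : 0 < Real.sin (Real.pi * x) :=
    Real.sin_pos_of_pos_of_lt_pi (by positivity) (by nlinarith)
  have hsy : 0 < Real.sin (Real.pi * y) :=
    Real.sin_pos_of_pos_of_lt_pi (by nlinarith) (by nlinarith)
  have hd : 0 ≤ Real.sin (Real.pi * y - Real.pi * x) :=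
    Real.sin_nonneg_of_nonneg_of_le_pi (by nlinarith) (by nlinarith)
  have hmono : 0 ≤ Real.cos (Real.pi * x) / Real.sin (Real.pi * x) -
        Real.cos (Real.pi * y) / Real.sin (Real.pi * y) := by
    rw [div_sub_div _ _ hsx.ne' hsy.ne']
    rw [Real.sin_sub] at hd
    apply div_nonneg _ (by positivity)
    linarith
  have h : cotWeight y - cotWeight x = ((-((Real.cos (Real.pi * x) / Real.sin (Real.pi * x) -
        Real.cos (Real.pi * y) / Real.sin (Real.pi * y)) / 2) : ℝ) : ℂ) * Complex.I := by
    rw [cotWeight, cotWeight]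
    push_cast
    ring
  rw [h, norm_mul, Complex.norm_I, mul_one, Complex.norm_real, norm_neg,
    Real.norm_of_nonneg (by linarith)]

lemma sum_sub_mul_eq (E W : ℕ → ℂ) (K : ℕ) :
    ∑ n ∈ range (K + 1), (E n - E (n + 1)) * W n =
      E 0 * W 0 - E (K + 1) * W K + ∑ n ∈ range K, E (n + 1) * (W (n + 1) - W n) := by
  induction K with
  | zero => simp; ring
  | succ K ih => rw [sum_range_succ, ih, sum_range_succ _ K]; ring

/-- The Kusmin–Landau inequality for a sequence of phases whose first differences increase and
stay at distance at least `δ` from the integers. -/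
lemma kusmin_landau (f : ℕ → ℝ) (k : ℤ) (K : ℕ) {δ : ℝ} (hδ : 0 < δ)
    (h1 : ∀ n < K, δ ≤ f (n + 1) - f n - k) (h2 : ∀ n < K, f (n + 1) - f n - k ≤ 1 - δ)
    (hmono : ∀ n, n + 1 < K → f (n + 1) - f n ≤ f (n + 2) - f (n + 1)) :
    ‖∑ n ∈ range K, e2pi (f n)‖ ≤ 1 / δ := by
  rcases K with _ | K
  · simp; positivity
  set x : ℕ → ℝ := fun n => f (n + 1) - f n - k with hx
  set W : ℕ → ℂ := fun n => cotWeight (x n) with hW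
  set E : ℕ → ℂ := fun n => e2pi (f n) with hE
  set ct : ℕ → ℝ := fun n => Real.cos (Real.pi * x n) / Real.sin (Real.pi * x n) with hct
  have hs : ∀ n < K + 1, 2 * δ ≤ Real.sin (Real.pi * x n) := fun n hn =>
    two_mul_le_sin_pi_mul hδ (h1 n hn) (h2 n hn)
  have hsum : ∑ n ∈ range (K + 1), e2pi (f n) =
      ∑ n ∈ range (K + 1), (E n - E (n + 1)) * W n := by
    refine sum_congr rfl fun n hn => ?_
    have h3 := one_sub_e2pi_mul_cotWeight (x := x n)
      (by linarith [hs n (mem_range.1 hn)] : 0 < Real.sin (Real.pi * x n)).ne'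
    have h4 : E (n + 1) = E n * e2pi (x n) := by
      rw [hx, e2pi_sub_intCast]
      simp only [hE]
      rw [← e2pi_add]
      congr 1
      ring
    rw [h4]
    simp only [hW, hE]
    linear_combination -(e2pi (f n)) * h3
  have hcot : ∀ n < K + 1, |ct n| ≤ 1 / (2 * δ) := by
    intro n hn
    have := hs n hn
    simp only [hct]
    rw [abs_div, abs_of_pos (by linarith : 0 < Real.sin (Real.pi * x n))]
    gcongr
    exact Real.abs_cos_le_one _
  have hdiff : ∀ n ∈ range K, ‖E (n + 1) * (W (n + 1) - W n)‖ = ct n / 2 - ct (n + 1) / 2 := by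
    intro n hn
    have hn := mem_range.1 hn
    simp only [hE, hW, hct]
    rw [norm_mul, norm_e2pi, one_mul, norm_cotWeight_sub]
    · ring
    · linarith [h1 n (by omega)]
    · have := hmono n (by omega)
      simp only [hx]
      linarith
    · linarith [h2 (n + 1) (by omega)]
  rw [hsum, sum_sub_mul_eq]
  have hA : ‖∑ n ∈ range K, E (n + 1) * (W (n + 1) - W n)‖ ≤ ct 0 / 2 - ct K / 2 := by
    refine (norm_sum_le _ _).trans ?_
    rw [sum_congr rfl hdiff, sum_range_sub' (fun n => ct n / 2)]
  have hB : ‖E 0 * W 0‖ ≤ 1 / (4 * δ) := by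
    simp only [hE, hW]
    rw [norm_mul, norm_e2pi, one_mul]
    exact norm_cotWeight_le hδ (h1 0 (by omega)) (h2 0 (by omega))
  have hC : ‖E (K + 1) * W K‖ ≤ 1 / (4 * δ) := by
    simp only [hE, hW]
    rw [norm_mul, norm_e2pi, one_mul]
    exact norm_cotWeight_le hδ (h1 K (by omega)) (h2 K (by omega))
  have h0 := abs_le.1 (hcot 0 (by omega))
  have hK := abs_le.1 (hcot K (by omega))
  have e1 : 1 / (4 * δ) = 1 / δ / 4 := by field_simp
  have e2 : 1 / (2 * δ) = 1 / δ / 2 := by field_simp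
  rw [e1] at hB hC
  rw [e2] at h0 hK
  have := norm_add_le (E 0 * W 0 - E (K + 1) * W K)
    (∑ n ∈ range K, E (n + 1) * (W (n + 1) - W n))
  have := norm_sub_le (E 0 * W 0) (E (K + 1) * W K)
  linarith

lemma exists_eq_Ico_of_convex (S : Finset ℕ)
    (hS : ∀ a ∈ S, ∀ b ∈ S, ∀ c, a ≤ c → c ≤ b → c ∈ S) : ∃ a L, S = Ico a (a + L) := by
  rcases S.eq_empty_or_nonempty with rfl | hne
  · exact ⟨0, 0, by simp⟩
  · refine ⟨S.min' hne, S.max' hne + 1 - S.min' hne, ?_⟩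
    have h := S.min'_le_max' hne
    ext c
    rw [mem_Ico]
    constructor
    · intro hc
      have h1 := S.min'_le c hc
      have h2 := S.le_max' c hc
      omega
    · rintro ⟨h1, h2⟩
      exact hS _ (S.min'_mem hne) _ (S.max'_mem hne) c h1 (by omega)

lemma add_mul_le_of_le_succ {g : ℕ → ℝ} {K : ℕ} {μ : ℝ} (hg : ∀ n < K, g n + μ ≤ g (n + 1))
    {a b : ℕ} (hab : a ≤ b) (hb : b ≤ K) : g a + (b - a : ℝ) * μ ≤ g b := by
  induction b, hab using Nat.le_induction with
  | base => simp
  | succ b hab ih =>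
    have h1 := ih (by omega)
    have h2 := hg b (by omega)
    push_cast
    linarith

lemma card_le_of_le_succ {g : ℕ → ℝ} {K : ℕ} {μ u δ : ℝ} (hμ : 0 < μ) (hδ : 0 ≤ δ)
    (hg : ∀ n < K, g n + μ ≤ g (n + 1)) (S : Finset ℕ) (hSK : ∀ n ∈ S, n ≤ K)
    (h1 : ∀ n ∈ S, u ≤ g n) (h2 : ∀ n ∈ S, g n ≤ u + δ) : (#S : ℝ) ≤ δ / μ + 1 := by
  rcases S.eq_empty_or_nonempty with rfl | hne
  · simp; positivity
  · have hmem := S.min'_mem hne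
    have hmem' := S.max'_mem hne
    have h := S.min'_le_max' hne
    have hsub : S ⊆ Icc (S.min' hne) (S.max' hne) := fun c hc =>
      mem_Icc.2 ⟨S.min'_le c hc, S.le_max' c hc⟩
    have hcard := card_le_card hsub
    rw [Nat.card_Icc] at hcard
    have h3 := add_mul_le_of_le_succ hg h (hSK _ hmem')
    have h4 := h1 _ hmem
    have h5 := h2 _ hmem'
    have h6 : (#S : ℝ) ≤ S.max' hne + 1 - S.min' hne := by
      have : #S + S.min' hne ≤ S.max' hne + 1 := by omega
      have : (#S : ℝ) + S.min' hne ≤ S.max' hne + 1 := by exact_mod_cast this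
      linarith
    have h7 : (S.max' hne - S.min' hne : ℝ) ≤ δ / μ := by
      rw [le_div_iff₀ hμ]
      linarith
    linarith

lemma norm_sum_e2pi_le_card (S : Finset ℕ) (f : ℕ → ℝ) : ‖∑ n ∈ S, e2pi (f n)‖ ≤ #S := by
  refine (norm_sum_le _ _).trans ?_
  simp [norm_e2pi]

lemma kusmin_landau_finset (f : ℕ → ℝ) (k : ℤ) (K : ℕ) {δ : ℝ} (hδ : 0 < δ)
    (hmono : ∀ n < K, f (n + 1) - f n ≤ f (n + 2) - f (n + 1)) (S : Finset ℕ)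
    (hS : ∀ a ∈ S, ∀ b ∈ S, ∀ c, a ≤ c → c ≤ b → c ∈ S) (hSK : ∀ n ∈ S, n < K)
    (h1 : ∀ n ∈ S, δ ≤ f (n + 1) - f n - k) (h2 : ∀ n ∈ S, f (n + 1) - f n - k ≤ 1 - δ) :
    ‖∑ n ∈ S, e2pi (f n)‖ ≤ 1 / δ := by
  obtain ⟨a, L, rfl⟩ := exists_eq_Ico_of_convex S hS
  have hmem : ∀ n < L, a + n ∈ Ico a (a + L) := fun n hn => by simp [hn]
  rw [sum_Ico_eq_sum_range, Nat.add_sub_cancel_left]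
  refine kusmin_landau (fun n => f (a + n)) k L hδ ?_ ?_ ?_
  · exact fun n hn => h1 _ (hmem n hn)
  · exact fun n hn => h2 _ (hmem n hn)
  · exact fun n hn => hmono _ (hSK _ (hmem n (by omega)))

lemma norm_sum_e2pi_floor_fiber_le (f : ℕ → ℝ) (k : ℤ) (K : ℕ) {μ : ℝ} (hμ : 0 < μ)
    (hμ1 : μ ≤ 1) (hf : ∀ n < K, f (n + 1) - f n + μ ≤ f (n + 2) - f (n + 1)) :
    ‖∑ n ∈ range K with ⌊f (n + 1) - f n⌋ = k, e2pi (f n)‖ ≤ 5 / √μ := by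
  set g : ℕ → ℝ := fun n => f (n + 1) - f n with hg
  set δ := √μ with hδ
  have hδ0 : 0 < δ := Real.sqrt_pos.2 hμ
  have hδ1 : δ ≤ 1 := Real.sqrt_le_one.2 hμ1
  have hδμ : δ * δ = μ := Real.mul_self_sqrt hμ.le
  have hstep : ∀ n < K, g n + μ ≤ g (n + 1) := hf
  have hmono : ∀ {a b : ℕ}, a ≤ b → b ≤ K → g a ≤ g b := fun {a b} hab hb => by
    have h1 := add_mul_le_of_le_succ hstep hab hb
    have h2 : (a : ℝ) ≤ b := by exact_mod_cast hab
    nlinarith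
  set S := {n ∈ range K | ⌊f (n + 1) - f n⌋ = k} with hS
  have hmemS : ∀ n, n ∈ S ↔ n < K ∧ (k : ℝ) ≤ g n ∧ g n < k + 1 := by
    intro n
    rw [hS, mem_filter, mem_range, Int.floor_eq_iff]
  have hδμ' : δ / μ = 1 / δ := by rw [← hδμ]; field_simp
  have hA : (#{n ∈ S | g n < k + δ} : ℝ) ≤ 1 / δ + 1 := by
    rw [← hδμ']
    refine card_le_of_le_succ (u := k) hμ hδ0.le hstep _ ?_ ?_ ?_ <;> intro n hn <;>
      simp only [mem_filter, hmemS] at hn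
    · exact hn.1.1.le
    · exact hn.1.2.1
    · exact hn.2.le
  have hB : (#{n ∈ {n ∈ S | ¬ g n < k + δ} | ¬ g n ≤ k + 1 - δ} : ℝ) ≤ 1 / δ + 1 := by
    rw [← hδμ']
    refine card_le_of_le_succ (u := k + 1 - δ) hμ hδ0.le hstep _ ?_ ?_ ?_ <;> intro n hn <;>
      simp only [mem_filter, hmemS, not_le] at hn
    · exact hn.1.1.1.le
    · exact hn.2.le
    · linarith [hn.1.1.2.2]
  have hC : ‖∑ n ∈ {n ∈ {n ∈ S | ¬ g n < k + δ} | g n ≤ k + 1 - δ}, e2pi (f n)‖ ≤ 1 / δ := by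
    refine kusmin_landau_finset f k K hδ0 (fun n hn => by linarith [hf n hn]) _ ?_ ?_ ?_ ?_
    · intro a ha b hb c hac hcb
      simp only [mem_filter, hmemS, not_lt] at ha hb ⊢
      have h1 := hmono hac (hcb.trans hb.1.1.1.le)
      have h2 := hmono hcb hb.1.1.1.le
      exact ⟨⟨⟨by omega, by linarith, by linarith⟩, by linarith⟩, by linarith⟩
    all_goals
      intro n hn
      simp only [mem_filter, hmemS, not_lt, hg] at hn
    · exact hn.1.1.1
    · linarith
    · linarith
  rw [← sum_filter_add_sum_filter_not S (fun n => g n < k + δ),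
    ← sum_filter_add_sum_filter_not {n ∈ S | ¬ g n < k + δ} (fun n => g n ≤ k + 1 - δ)]
  have h1 := (norm_sum_e2pi_le_card {n ∈ S | g n < k + δ} f).trans hA
  have h2 := (norm_sum_e2pi_le_card
    {n ∈ {n ∈ S | ¬ g n < k + δ} | ¬ g n ≤ k + 1 - δ} f).trans hB
  refine (norm_add_le _ _).trans ?_
  have h3 := (norm_add_le _ _).trans (add_le_add hC h2)
  refine (add_le_add h1 h3).trans ?_
  have h5 : 1 ≤ 1 / δ := by rw [le_div_iff₀ hδ0]; linarith
  have h4 : 5 / δ = 5 * (1 / δ) := by ring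
  linarith

/-- The van der Corput second derivative test, with second differences in place of second
derivatives. -/
lemma second_difference_test (f : ℕ → ℝ) (K : ℕ) {μ H : ℝ} (hμ : 0 < μ) (hH : 1 ≤ H)
    (h1 : ∀ n < K, μ ≤ f (n + 2) - 2 * f (n + 1) + f n)
    (h2 : ∀ n < K, f (n + 2) - 2 * f (n + 1) + f n ≤ H * μ) :
    ‖∑ n ∈ range K, e2pi (f n)‖ ≤ 10 * H * (K * √μ + 1 / √μ) := by
  have hs : 0 < √μ := Real.sqrt_pos.2 hμ
  rcases le_total 1 μ with hμ1 | hμ1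
  · have h := norm_sum_e2pi_le_card (range K) f
    rw [card_range] at h
    have h3 : 1 ≤ √μ := Real.one_le_sqrt.2 hμ1
    have h4 : (K : ℝ) ≤ K * √μ := le_mul_of_one_le_right (by positivity) h3
    have h5 : 0 < 1 / √μ := by positivity
    nlinarith
  · rcases Nat.eq_zero_or_pos K with rfl | hK
    · simp; positivity
    set g : ℕ → ℝ := fun n => f (n + 1) - f n with hg
    have hstep : ∀ n < K, g n + μ ≤ g (n + 1) := fun n hn => by
      simp only [hg]; linarith [h1 n hn]
    have hstep' : ∀ n < K, (-g) n + (-(H * μ)) ≤ (-g) (n + 1) := fun n hn => by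
      simp only [hg, Pi.neg_apply]; linarith [h2 n hn]
    have hmaps : ∀ n ∈ range K, ⌊g n⌋ ∈ Icc ⌊g 0⌋ ⌊g K⌋ := by
      intro n hn
      have hn := mem_range.1 hn
      have e1 := add_mul_le_of_le_succ hstep (Nat.zero_le n) hn.le
      have e2 := add_mul_le_of_le_succ hstep hn.le le_rfl
      have e3 : (n : ℝ) ≤ K := by exact_mod_cast hn.le
      have e4 : 0 ≤ (K - n : ℝ) * μ := mul_nonneg (by linarith) hμ.le
      have e5 : 0 ≤ (n : ℝ) * μ := by positivity
      push_cast at e1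
      exact mem_Icc.2 ⟨Int.floor_le_floor (by linarith), Int.floor_le_floor (by linarith)⟩
    rw [← sum_fiberwise_of_maps_to hmaps]
    have hfib : ∀ k ∈ Icc ⌊g 0⌋ ⌊g K⌋,
        ‖∑ n ∈ range K with ⌊g n⌋ = k, e2pi (f n)‖ ≤ 5 / √μ := fun k _ =>
      norm_sum_e2pi_floor_fiber_le f k K hμ hμ1 (fun n hn => by linarith [h1 n hn])
    refine (norm_sum_le_of_le _ hfib).trans ?_
    rw [sum_const, nsmul_eq_mul, Int.card_Icc]
    have hrange : g K - g 0 ≤ H * μ * K := by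
      have := add_mul_le_of_le_succ hstep' (Nat.zero_le K) le_rfl
      simp only [Pi.neg_apply] at this
      push_cast at this
      linarith
    have hcount : (((⌊g K⌋ + 1 - ⌊g 0⌋).toNat : ℕ) : ℝ) ≤ H * μ * K + 2 := by
      have h0 : ⌊g 0⌋ ≤ ⌊g K⌋ := by
        have := hmaps 0 (mem_range.2 hK)
        rw [mem_Icc] at this
        exact this.2
      have h3 : (((⌊g K⌋ + 1 - ⌊g 0⌋).toNat : ℤ) : ℝ) = ⌊g K⌋ + 1 - ⌊g 0⌋ := by
        rw [Int.toNat_of_nonneg (by omega)]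
        push_cast
        ring
      rw [Int.cast_natCast] at h3
      rw [h3]
      linarith [Int.floor_le (g K), Int.lt_floor_add_one (g 0)]
    calc _ ≤ (H * μ * K + 2) * (5 / √μ) := by gcongr
      _ = 5 * H * (K * √μ) + 10 * (1 / √μ) := by
        have hq : √μ * √μ = μ := Real.mul_self_sqrt hμ.le
        field_simp
        nlinarith
      _ ≤ _ := by
        have h5 : 0 < 1 / √μ := by positivity
        have h6 : 0 ≤ K * √μ := by positivity
        nlinarith

lemma sum_Ico_add_eq {F : ℤ → ℂ} {K Q q : ℕ} (hF : ∀ n, n ∉ Ico (0 : ℤ) K → F n = 0)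
    (hq : q < Q) : ∑ n ∈ Ico (-Q : ℤ) K, F (n + q) = ∑ n ∈ Ico (0 : ℤ) K, F n := by
  have h := sum_map (Ico (-Q : ℤ) K) (addRightEmbedding (q : ℤ)) F
  rw [map_add_right_Ico] at h
  simp only [addRightEmbedding_apply] at h
  rw [← h]
  symm
  refine sum_subset ?_ fun n _ hn => hF n hn
  intro n hn
  rw [mem_Ico] at hn ⊢
  omega

lemma norm_autocorrelation_le {z : ℤ → ℂ} {K Q : ℕ} (hz : ∀ n, n ∉ Ico (0 : ℤ) K → z n = 0)
    {B : ℕ → ℝ} (hB : ∀ q < Q, ‖∑ n ∈ Ico (0 : ℤ) K, z (n + q) * (starRingEnd ℂ) (z n)‖ ≤ B q)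
    {r s : ℕ} (hrs : r ≤ s) (hs : s < Q) :
    ‖∑ n ∈ Ico (-Q : ℤ) K, z (n + s) * (starRingEnd ℂ) (z (n + r))‖ ≤ B (s - r) := by
  have h := sum_Ico_add_eq (F := fun n => z (n + (s - r : ℕ)) * (starRingEnd ℂ) (z n))
    (K := K) (Q := Q) (q := r) (fun n hn => by simp [hz n hn]) (by omega)
  have h2 : ∀ n : ℤ, n + r + (s - r : ℕ) = n + s := fun n => by omega
  simp only [h2] at h
  rw [h]
  exact hB _ (by omega)

lemma sum_dist_le (B : ℕ → ℝ) (hB : ∀ q, 0 ≤ B q) {Q s : ℕ} (hs : s < Q) :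
    ∑ r ∈ range Q, B (if r ≤ s then s - r else r - s) ≤ 2 * ∑ q ∈ range Q, B q := by
  have key : ∀ (S : Finset ℕ) (φ : ℕ → ℕ), (∀ r ∈ S, φ r < Q) → Set.InjOn φ S →
      ∑ r ∈ S, B (φ r) ≤ ∑ q ∈ range Q, B q := by
    intro S φ hφ hinj
    rw [← sum_image (f := B) hinj]
    refine sum_le_sum_of_subset_of_nonneg ?_ fun q _ _ => hB q
    intro q hq
    obtain ⟨r, hr, rfl⟩ := mem_image.1 hq
    exact mem_range.2 (hφ r hr)
  rw [← sum_filter_add_sum_filter_not (range Q) (fun r => r ≤ s), two_mul]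
  refine add_le_add ?_ ?_ <;> refine key _ _ ?_ ?_
  · intro r _
    split_ifs <;> simp_all; omega
  · intro a ha b hb hab
    rw [mem_coe, mem_filter] at ha hb
    simp only [ha.2, hb.2, if_true] at hab
    omega
  · intro r hr
    simp only [mem_filter, mem_range] at hr
    rw [if_neg hr.2]
    omega
  · intro a ha b hb hab
    rw [mem_coe, mem_filter] at ha hb
    simp only [ha.2, hb.2, if_false] at hab
    omega

/-- The Weyl–van der Corput inequality. -/
lemma weyl_van_der_corput {z : ℤ → ℂ} {K Q : ℕ} (hz : ∀ n, n ∉ Ico (0 : ℤ) K → z n = 0)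
    {B : ℕ → ℝ} (hB0 : ∀ q, 0 ≤ B q)
    (hB : ∀ q < Q, ‖∑ n ∈ Ico (0 : ℤ) K, z (n + q) * (starRingEnd ℂ) (z n)‖ ≤ B q) :
    (Q : ℝ) ^ 2 * ‖∑ n ∈ Ico (0 : ℤ) K, z n‖ ^ 2 ≤
      (K + Q) * (Q * (2 * ∑ q ∈ range Q, B q)) := by
  set A := Ico (-Q : ℤ) K with hA
  have hcardA : (#A : ℝ) = K + Q := by
    rw [hA, Int.card_Ico]
    have : ((K : ℤ) - -Q).toNat = K + Q := by omega
    rw [this]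
    push_cast
    rfl
  have h1 : (Q : ℂ) * ∑ n ∈ Ico (0 : ℤ) K, z n = ∑ n ∈ A, ∑ q ∈ range Q, z (n + q) := by
    rw [sum_comm, sum_congr rfl fun q hq => sum_Ico_add_eq hz (mem_range.1 hq)]
    simp
  have h2 : (Q : ℝ) * ‖∑ n ∈ Ico (0 : ℤ) K, z n‖ ≤ ∑ n ∈ A, ‖∑ q ∈ range Q, z (n + q)‖ := by
    have := congrArg norm h1
    rw [norm_mul, Complex.norm_natCast] at this
    rw [this]
    exact norm_sum_le _ _
  have h3 : ((Q : ℝ) * ‖∑ n ∈ Ico (0 : ℤ) K, z n‖) ^ 2 ≤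
      #A * ∑ n ∈ A, ‖∑ q ∈ range Q, z (n + q)‖ ^ 2 :=
    (pow_le_pow_left₀ (by positivity) h2 2).trans sq_sum_le_card_mul_sum_sq
  have h4 : ((∑ n ∈ A, ‖∑ q ∈ range Q, z (n + q)‖ ^ 2 : ℝ) : ℂ) =
      ∑ s ∈ range Q, ∑ r ∈ range Q, ∑ n ∈ A, z (n + s) * (starRingEnd ℂ) (z (n + r)) := by
    have e1 : ∀ n, ((‖∑ q ∈ range Q, z (n + q)‖ ^ 2 : ℝ) : ℂ) =
        ∑ s ∈ range Q, ∑ r ∈ range Q, z (n + s) * (starRingEnd ℂ) (z (n + r)) := by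
      intro n
      rw [Complex.ofReal_pow, ← Complex.mul_conj', map_sum, sum_mul_sum]
    rw [Complex.ofReal_sum, sum_congr rfl fun n _ => e1 n, sum_comm]
    exact sum_congr rfl fun s _ => sum_comm
  have h5 : ∑ n ∈ A, ‖∑ q ∈ range Q, z (n + q)‖ ^ 2 ≤ Q * (2 * ∑ q ∈ range Q, B q) := by
    have e0 : 0 ≤ ∑ n ∈ A, ‖∑ q ∈ range Q, z (n + q)‖ ^ 2 := by positivity
    have e1 := congrArg norm h4
    rw [Complex.norm_real, Real.norm_of_nonneg e0] at e1
    rw [e1]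
    have e2 : ∀ s ∈ range Q,
        ‖∑ r ∈ range Q, ∑ n ∈ A, z (n + s) * (starRingEnd ℂ) (z (n + r))‖ ≤
          2 * ∑ q ∈ range Q, B q := by
      intro s hs
      have hs := mem_range.1 hs
      refine (norm_sum_le_of_le _ fun r hr => ?_).trans (sum_dist_le B hB0 hs)
      have hr := mem_range.1 hr
      split_ifs with hrs
      · exact norm_autocorrelation_le hz hB hrs hs
      · rw [← Complex.norm_conj, map_sum]
        simp only [map_mul, Complex.conj_conj, mul_comm ((starRingEnd ℂ) _)]
        exact norm_autocorrelation_le hz hB (by omega) hr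
    refine (norm_sum_le_of_le _ e2).trans ?_
    simp
  rw [hcardA] at h3
  rw [← mul_pow]
  exact h3.trans (by gcongr)

lemma sum_one_div_sqrt_le (D : ℕ) : ∑ d ∈ Icc 1 D, 1 / √(d : ℝ) ≤ 2 * √(D : ℝ) := by
  induction D with
  | zero => simp
  | succ D ih =>
    rw [sum_Icc_succ_top (by omega)]
    have h0 : 0 < √((D + 1 : ℕ) : ℝ) := Real.sqrt_pos.2 (by positivity)
    have h1 : √((D + 1 : ℕ) : ℝ) ^ 2 = D + 1 := by
      rw [Real.sq_sqrt (by positivity)]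
      push_cast
      rfl
    have h2 : √(D : ℝ) ^ 2 = D := Real.sq_sqrt (by positivity)
    have h3 : 1 / √((D + 1 : ℕ) : ℝ) ≤ 2 * √((D + 1 : ℕ) : ℝ) - 2 * √(D : ℝ) := by
      rw [div_le_iff₀ h0]
      nlinarith [sq_nonneg (√((D + 1 : ℕ) : ℝ) - √(D : ℝ))]
    linarith

lemma third_difference_shift_bounds (f : ℕ → ℝ) (n q : ℕ) {lo hi : ℝ}
    (h1 : ∀ j < q, lo ≤ f (n + j + 3) - 3 * f (n + j + 2) + 3 * f (n + j + 1) - f (n + j))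
    (h2 : ∀ j < q, f (n + j + 3) - 3 * f (n + j + 2) + 3 * f (n + j + 1) - f (n + j) ≤ hi) :
    q * lo ≤ (f (n + q + 2) - f (n + 2)) - 2 * (f (n + q + 1) - f (n + 1)) + (f (n + q) - f n) ∧
    (f (n + q + 2) - f (n + 2)) - 2 * (f (n + q + 1) - f (n + 1)) + (f (n + q) - f n) ≤
      q * hi := by
  induction q with
  | zero => simp
  | succ q ih =>
    have h := ih (fun j hj => h1 j (by omega)) (fun j hj => h2 j (by omega))
    have e1 := h1 q (by omega)
    have e2 := h2 q (by omega)
    rw [show n + (q + 1) + 2 = n + q + 3 by ring, show n + (q + 1) + 1 = n + q + 2 by ring,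
      show n + (q + 1) = n + q + 1 by ring]
    push_cast
    constructor <;> linarith

/-- The phases `e2pi (f n)` for `n < K`, extended by zero to the integers. -/
noncomputable def truncatedPhase (f : ℕ → ℝ) (K : ℕ) (n : ℤ) : ℂ :=
  if n ∈ Ico (0 : ℤ) K then e2pi (f n.toNat) else 0

lemma sum_Ico_intCast (F : ℤ → ℂ) (K : ℕ) :
    ∑ n ∈ Ico (0 : ℤ) K, F n = ∑ n ∈ range K, F n := by
  symm
  refine sum_nbij (fun n : ℕ => (n : ℤ)) ?_ ?_ ?_ ?_
  · intro n hn
    simpa using hn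
  · exact Nat.cast_injective.injOn
  · intro n hn
    rw [mem_coe, mem_Ico] at hn
    refine ⟨n.toNat, ?_, ?_⟩
    · rw [mem_coe, mem_range]
      omega
    · simp [hn.1]
  · intro _ _
    rfl

lemma sum_truncatedPhase (f : ℕ → ℝ) (K : ℕ) :
    ∑ n ∈ Ico (0 : ℤ) K, truncatedPhase f K n = ∑ n ∈ range K, e2pi (f n) := by
  rw [sum_Ico_intCast]
  refine sum_congr rfl fun n hn => ?_
  have hn := mem_range.1 hn
  rw [truncatedPhase, if_pos (by rw [mem_Ico]; omega), Int.toNat_natCast]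

lemma autocorrelation_truncatedPhase (f : ℕ → ℝ) (K q : ℕ) :
    ∑ n ∈ Ico (0 : ℤ) K,
        truncatedPhase f K (n + q) * (starRingEnd ℂ) (truncatedPhase f K n) =
      ∑ n ∈ range (K - q), e2pi (f (n + q) - f n) := by
  rw [sum_Ico_intCast]
  symm
  refine sum_subset_zero_on_sdiff (range_subset_range.2 (Nat.sub_le K q)) ?_ ?_
  · intro n hn
    rw [mem_sdiff, mem_range, mem_range] at hn
    rw [truncatedPhase, if_neg (by rw [mem_Ico]; omega), zero_mul]
  · intro n hn
    have hn := mem_range.1 hn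
    rw [truncatedPhase, truncatedPhase, if_pos (by rw [mem_Ico]; omega),
      if_pos (by rw [mem_Ico]; omega), conj_e2pi, ← e2pi_add, Int.toNat_natCast,
      ← Nat.cast_add, Int.toNat_natCast, sub_eq_add_neg]

lemma sum_range_one_div_sqrt_le (Q : ℕ) : ∑ q ∈ range Q, 1 / √(q : ℝ) ≤ 2 * √(Q : ℝ) := by
  refine le_trans ?_ (sum_one_div_sqrt_le Q)
  have h : ∑ q ∈ Icc 1 Q, 1 / √(q : ℝ) = ∑ q ∈ Icc 0 Q, 1 / √(q : ℝ) := by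
    refine sum_subset (Icc_subset_Icc_left (by omega)) fun q hq hq' => ?_
    have : q = 0 := by
      rw [mem_Icc] at hq hq'
      omega
    simp [this]
  rw [h]
  refine sum_le_sum_of_subset_of_nonneg (fun q hq => ?_) fun _ _ _ => by positivity
  rw [mem_range] at hq
  rw [mem_Icc]
  omega

/-- The van der Corput third derivative test, with third differences of size `t ^ 6` in place of
third derivatives. -/
lemma third_difference_test (f : ℕ → ℝ) (K : ℕ) {t H : ℝ} (ht : 0 < t) (hH : 1 ≤ H)
    (h1 : ∀ n < K, t ^ 6 ≤ f (n + 3) - 3 * f (n + 2) + 3 * f (n + 1) - f n)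
    (h2 : ∀ n < K, f (n + 3) - 3 * f (n + 2) + 3 * f (n + 1) - f n ≤ H * t ^ 6) :
    ‖∑ n ∈ range K, e2pi (f n)‖ ≤ 20 * H * (K * t + √K / t) := by
  have htriv := norm_sum_e2pi_le_card (range K) f
  rw [card_range] at htriv
  have hK0 : (0 : ℝ) ≤ K := by positivity
  have hsK : √(K : ℝ) ^ 2 = K := Real.sq_sqrt hK0
  have hsKt : 0 ≤ √(K : ℝ) / t := by positivity
  have hKt : 0 ≤ K * t := by positivity
  rcases le_total 1 t with ht1 | ht1
  · have : (K : ℝ) ≤ K * t := le_mul_of_one_le_right hK0 ht1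
    nlinarith
  set Q : ℕ := ⌈1 / t ^ 2⌉₊ with hQ
  have hx1 : 1 ≤ 1 / t ^ 2 := by
    rw [le_div_iff₀ (by positivity)]
    nlinarith
  have hQ1 : 1 / t ^ 2 ≤ Q := Nat.le_ceil _
  have hQ2 : (Q : ℝ) ≤ 2 / t ^ 2 := by
    have := (Nat.ceil_lt_add_one (by linarith : 0 ≤ 1 / t ^ 2)).le
    have e : 2 / t ^ 2 = 2 * (1 / t ^ 2) := by ring
    rw [← hQ] at this
    linarith
  rcases lt_or_ge K Q with hKQ | hKQ
  · have h3 : (K : ℝ) ≤ 2 / t ^ 2 := (by exact_mod_cast hKQ.le : (K : ℝ) ≤ Q).trans hQ2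
    have h4 : √(K : ℝ) ≤ 2 / t := by
      rw [Real.sqrt_le_left (by positivity), div_pow]
      refine h3.trans ?_
      gcongr
      norm_num
    have h5 : (K : ℝ) ≤ 2 * (√K / t) := by
      calc (K : ℝ) = √K * √K := by rw [← sq, hsK]
        _ ≤ √K * (2 / t) := by gcongr
        _ = _ := by ring
    nlinarith
  have hKQ' : (Q : ℝ) ≤ K := by exact_mod_cast hKQ
  have hQ0 : (0 : ℝ) < Q := by linarith
  set B : ℕ → ℝ := fun q => if q = 0 then (K : ℝ) else
    10 * H * (K * (2 * t ^ 2) + 1 / t ^ 3 * (1 / √q)) with hB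
  have hB0 : ∀ q, 0 ≤ B q := by
    intro q
    simp only [hB]
    split_ifs <;> positivity
  have hBz : ∀ q < Q, ‖∑ n ∈ Ico (0 : ℤ) K,
      truncatedPhase f K (n + q) * (starRingEnd ℂ) (truncatedPhase f K n)‖ ≤ B q := by
    intro q hq
    rw [autocorrelation_truncatedPhase]
    have htriv' := norm_sum_e2pi_le_card (range (K - q)) (fun n => f (n + q) - f n)
    simp only [hB]
    split_ifs with hq0
    · subst hq0
      simpa using htriv'
    · have hq1 : (0 : ℝ) < q := by exact_mod_cast Nat.pos_of_ne_zero hq0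
      have hμ : (0 : ℝ) < q * t ^ 6 := by positivity
      have hbd : ∀ n < K - q, _ := fun n hn => third_difference_shift_bounds f n q
        (fun j hj => h1 (n + j) (by omega)) (fun j hj => h2 (n + j) (by omega))
      have h := second_difference_test (fun n => f (n + q) - f n) (K - q) hμ hH
        (fun n hn => by
          have := (hbd n hn).1
          rw [show n + 2 + q = n + q + 2 by ring, show n + 1 + q = n + q + 1 by ring]
          linarith)
        (fun n hn => by
          have := (hbd n hn).2
          rw [show n + 2 + q = n + q + 2 by ring, show n + 1 + q = n + q + 1 by ring]
          linarith)
      refine h.trans ?_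
      have hsq : √((q : ℝ) * t ^ 6) = √q * t ^ 3 := by
        rw [Real.sqrt_mul hq1.le, show t ^ 6 = (t ^ 3) ^ 2 by ring,
          Real.sqrt_sq (by positivity)]
      have hq2 : √(q : ℝ) ≤ 2 / t := by
        rw [Real.sqrt_le_left (by positivity), div_pow]
        refine ((by exact_mod_cast hq.le : (q : ℝ) ≤ Q).trans hQ2).trans ?_
        gcongr
        norm_num
      have hsq' : √(q : ℝ) * t ^ 3 ≤ 2 * t ^ 2 := by
        calc √(q : ℝ) * t ^ 3 ≤ 2 / t * t ^ 3 := by gcongr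
          _ = 2 * t ^ 2 := by field_simp
      have hinv : 1 / (√(q : ℝ) * t ^ 3) = 1 / t ^ 3 * (1 / √q) := by field_simp
      rw [hsq, hinv]
      gcongr
      exact Nat.sub_le K q
  have hvdc := weyl_van_der_corput (z := truncatedPhase f K) (K := K) (Q := Q)
    (fun n hn => by rw [truncatedPhase, if_neg hn]) hB0 hBz
  rw [sum_truncatedPhase] at hvdc
  have hsumB : ∑ q ∈ range Q, B q ≤
      K + 10 * H * (Q * (K * (2 * t ^ 2)) + 4 / t ^ 4) := by
    have e1 : ∀ q ∈ range Q, B q ≤ (if q = 0 then (K : ℝ) else 0) +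
        10 * H * (K * (2 * t ^ 2) + 1 / t ^ 3 * (1 / √q)) := by
      intro q _
      have : 0 ≤ 10 * H * (K * (2 * t ^ 2) + 1 / t ^ 3 * (1 / √q)) := by positivity
      simp only [hB]
      split_ifs <;> linarith
    refine (sum_le_sum e1).trans ?_
    rw [sum_add_distrib, ← mul_sum, sum_add_distrib, ← mul_sum, sum_const, card_range,
      nsmul_eq_mul]
    have e2 : ∑ q ∈ range Q, (if q = 0 then (K : ℝ) else 0) ≤ K := by
      rw [sum_ite_eq']
      split_ifs <;> linarith
    have e3 := sum_range_one_div_sqrt_le Q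
    have e4 : √(Q : ℝ) ≤ 2 / t := by
      rw [Real.sqrt_le_left (by positivity), div_pow]
      refine hQ2.trans ?_
      gcongr
      norm_num
    have e5 : 1 / t ^ 3 * ∑ q ∈ range Q, 1 / √(q : ℝ) ≤ 4 / t ^ 4 := by
      calc _ ≤ 1 / t ^ 3 * (2 * (2 / t)) := by gcongr; linarith
        _ = _ := by field_simp; norm_num
    rw [mul_sum] at e5
    exact add_le_add e2 (mul_le_mul_of_nonneg_left (by linarith) (by positivity))
  set S := ‖∑ n ∈ range K, e2pi (f n)‖ with hS
  have hmain : S ^ 2 ≤ 4 * K * (K * t ^ 2 + 10 * H * (K * (2 * t ^ 2) + 4 / t ^ 2)) := by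
    have hle : (Q : ℝ) ^ 2 * S ^ 2 ≤ (Q : ℝ) ^ 2 *
        (4 * K * (K * (1 / Q) + 10 * H * (K * (2 * t ^ 2) + 4 / t ^ 4 * (1 / Q)))) := by
      refine hvdc.trans ?_
      calc _ ≤ (K + K : ℝ) * (Q * (2 * (K + 10 * H * (Q * (K * (2 * t ^ 2)) + 4 / t ^ 4)))) := by
            gcongr
        _ = _ := by field_simp; ring
    have hinvQ : 1 / (Q : ℝ) ≤ t ^ 2 := by
      rw [div_le_comm₀ hQ0 (by positivity)]
      exact hQ1
    refine (le_of_mul_le_mul_left hle (by positivity)).trans ?_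
    have e : 4 / t ^ 2 = 4 / t ^ 4 * t ^ 2 := by field_simp
    rw [e]
    gcongr
  have hexp : 4 * K * (K * t ^ 2 + 10 * H * (K * (2 * t ^ 2) + 4 / t ^ 2)) =
      (4 + 80 * H) * (K * t) ^ 2 + 160 * H * (√K / t) ^ 2 := by
    rw [div_pow, hsK]
    ring
  rw [hexp] at hmain
  refine (sq_le_sq₀ (norm_nonneg _) (by positivity)).1 (hmain.trans ?_)
  have e1 : 0 ≤ (K * t) ^ 2 := sq_nonneg _
  have e2 : 0 ≤ (√K / t) ^ 2 := sq_nonneg _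
  have e3 : 0 ≤ K * t * (√K / t) := mul_nonneg hKt hsKt
  have e4 : 4 + 80 * H ≤ 400 * H ^ 2 := by nlinarith
  have e5 : 160 * H ≤ 400 * H ^ 2 := by nlinarith
  have e6 := mul_le_mul_of_nonneg_right e4 e1
  have e7 := mul_le_mul_of_nonneg_right e5 e2
  have e8 : 0 ≤ H ^ 2 * (K * t * (√K / t)) := by positivity
  linear_combination e6 + e7 + 800 * e8

lemma exists_third_difference_eq {p p1 p2 p3 : ℝ → ℝ}
    (h1 : ∀ x, 0 < x → HasDerivAt p (p1 x) x) (h2 : ∀ x, 0 < x → HasDerivAt p1 (p2 x) x)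
    (h3 : ∀ x, 0 < x → HasDerivAt p2 (p3 x) x) {x : ℝ} (hx : 0 < x) :
    ∃ ξ, x ≤ ξ ∧ ξ ≤ x + 3 ∧ p (x + 3) - 3 * p (x + 2) + 3 * p (x + 1) - p x = p3 ξ := by
  have mvt : ∀ {q q' : ℝ → ℝ}, (∀ y, 0 < y → HasDerivAt q (q' y) y) → ∀ y, 0 < y →
      ∃ ξ, y ≤ ξ ∧ ξ ≤ y + 1 ∧ q (y + 1) - q y = q' ξ := by
    intro q q' hq y hy
    obtain ⟨ξ, hξ, h⟩ := exists_hasDerivAt_eq_slope q q' (lt_add_one y)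
      (fun z hz => (hq z (hy.trans_le hz.1)).continuousAt.continuousWithinAt)
      (fun z hz => hq z (hy.trans hz.1))
    exact ⟨ξ, hξ.1.le, hξ.2.le, by rw [h]; simp⟩
  have shift : ∀ {q q' : ℝ → ℝ} (a : ℝ), 0 ≤ a → (∀ y, 0 < y → HasDerivAt q (q' y) y) →
      ∀ y, 0 < y → HasDerivAt (fun z => q (z + a)) (q' (y + a)) y := fun a ha hq y hy =>
    (hq (y + a) (by linarith)).comp_add_const y a
  obtain ⟨u, hu1, hu2, hu⟩ := mvt (q := fun y => p (y + 2) - 2 * p (y + 1) + p y)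
    (q' := fun y => p1 (y + 2) - 2 * p1 (y + 1) + p1 y)
    (fun y hy => ((shift 2 (by norm_num) h1 y hy).sub
      ((shift 1 (by norm_num) h1 y hy).const_mul 2)).add (h1 y hy)) x hx
  obtain ⟨v, hv1, hv2, hv⟩ := mvt (q := fun y => p1 (y + 1) - p1 y)
    (q' := fun y => p2 (y + 1) - p2 y)
    (fun y hy => (shift 1 (by norm_num) h2 y hy).sub (h2 y hy)) u (by linarith)
  obtain ⟨w, hw1, hw2, hw⟩ := mvt h3 v (by linarith)
  refine ⟨w, by linarith, by linarith, ?_⟩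
  rw [show x + 1 + 2 = x + 3 by ring, show x + 1 + 1 = x + 2 by ring] at hu
  rw [show u + 1 + 1 = u + 2 by ring] at hv
  linarith

lemma exists_third_difference_rpow_eq (γ : ℝ) {x : ℝ} (hx : 0 < x) :
    ∃ ξ, x ≤ ξ ∧ ξ ≤ x + 3 ∧
      (x + 3) ^ γ - 3 * (x + 2) ^ γ + 3 * (x + 1) ^ γ - x ^ γ =
        γ * (γ - 1) * (γ - 2) * ξ ^ (γ - 3) := by
  refine exists_third_difference_eq (p := fun x => x ^ γ) (p1 := fun x => γ * x ^ (γ - 1))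
    (p2 := fun x => γ * (γ - 1) * x ^ (γ - 2)) (p3 := fun x => γ * (γ - 1) * (γ - 2) * x ^ (γ - 3))
    (fun y hy => Real.hasDerivAt_rpow_const (Or.inl hy.ne')) (fun y hy => ?_) (fun y hy => ?_) hx
  · have := (Real.hasDerivAt_rpow_const (p := γ - 1) (Or.inl hy.ne')).const_mul γ
    rw [show γ - 1 - 1 = γ - 2 by ring] at this
    exact this.congr_deriv (by ring)
  · have := (Real.hasDerivAt_rpow_const (p := γ - 2) (Or.inl hy.ne')).const_mul (γ * (γ - 1))
    rw [show γ - 2 - 1 = γ - 3 by ring] at this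
    exact this.congr_deriv (by ring)

/-- The exponential sum over `X < l ≤ Y` with phase a quadratic minus `A l ^ γ`; here `t ^ 6` is
a lower bound for the third differences of `A l ^ γ`. -/
lemma norm_sum_e2pi_quadratic_sub_rpow_le {γ : ℝ} (hγ0 : 0 < γ) (hγ1 : γ < 1) {A X Y t : ℝ}
    (b : ℝ) (hA : 0 < A) (hX : 0 < X) (hXY : X ≤ Y) (hY : Y ≤ 2 * X) (ht : 0 < t)
    (htA : t ^ 6 = A * (γ * (1 - γ) * (2 - γ)) * (8 * X) ^ (γ - 3)) :
    ‖∑ l ∈ Ioc ⌊X⌋₊ ⌊Y⌋₊, e2pi (b * (l : ℝ) ^ 2 - A * (l : ℝ) ^ γ)‖ ≤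
      20 * 8 ^ (3 - γ) * (3 * X * t + 2 * √X / t) := by
  have hH : (1 : ℝ) ≤ 8 ^ (3 - γ) := Real.one_le_rpow (by norm_num) (by linarith)
  rcases lt_or_ge Y 1 with hY1 | hY1
  · rw [(Nat.floor_eq_zero.2 hY1 : ⌊Y⌋₊ = 0)]
    simp
    positivity
  have hX2 : 1 / 2 ≤ X := by linarith
  have hfl : ⌊X⌋₊ ≤ ⌊Y⌋₊ := Nat.floor_le_floor hXY
  set a := ⌊X⌋₊ with ha
  set K := ⌊Y⌋₊ - a with hK
  have hKR : (K : ℝ) = ⌊Y⌋₊ - a := by rw [hK, Nat.cast_sub hfl]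
  have hYfl : (⌊Y⌋₊ : ℝ) ≤ Y := Nat.floor_le (by linarith)
  have hXfl : X < a + 1 := Nat.lt_floor_add_one X
  have hKX : (K : ℝ) ≤ 3 * X := by linarith
  set F : ℕ → ℝ := fun n => A * ((a + 1 + n : ℕ) : ℝ) ^ γ - b * ((a + 1 + n : ℕ) : ℝ) ^ 2 with hF
  have hsum : ∑ l ∈ Ioc a ⌊Y⌋₊, e2pi (b * (l : ℝ) ^ 2 - A * (l : ℝ) ^ γ) =
      (starRingEnd ℂ) (∑ n ∈ range K, e2pi (F n)) := by
    have : Ioc a ⌊Y⌋₊ = Ico (a + 1) (⌊Y⌋₊ + 1) := by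
      ext l
      rw [mem_Ioc, mem_Ico]
      omega
    rw [this, sum_Ico_eq_sum_range, map_sum, Nat.add_sub_add_right]
    refine sum_congr rfl fun n _ => ?_
    rw [conj_e2pi]
    simp only [hF]
    congr 1
    ring
  have hbounds : ∀ n < K, t ^ 6 ≤ F (n + 3) - 3 * F (n + 2) + 3 * F (n + 1) - F n ∧
      F (n + 3) - 3 * F (n + 2) + 3 * F (n + 1) - F n ≤ 8 ^ (3 - γ) * t ^ 6 := by
    intro n hn
    have hx : (0 : ℝ) < (a + 1 + n : ℕ) := by positivity
    obtain ⟨ξ, hξ1, hξ2, hξ⟩ := exists_third_difference_rpow_eq γ hx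
    set x : ℝ := ((a + 1 + n : ℕ) : ℝ) with hxdef
    have hxa : x = a + 1 + n := by rw [hxdef]; push_cast; ring
    have hdiff : F (n + 3) - 3 * F (n + 2) + 3 * F (n + 1) - F n =
        A * (γ * (1 - γ) * (2 - γ)) * ξ ^ (γ - 3) := by
      have e1 : ((a + 1 + (n + 1) : ℕ) : ℝ) = x + 1 := by rw [hxa]; push_cast; ring
      have e2 : ((a + 1 + (n + 2) : ℕ) : ℝ) = x + 2 := by rw [hxa]; push_cast; ring
      have e3 : ((a + 1 + (n + 3) : ℕ) : ℝ) = x + 3 := by rw [hxa]; push_cast; ring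
      simp only [hF, e1, e2, e3, ← hxdef]
      linear_combination A * hξ
    have hnK : (n : ℝ) + 1 ≤ K := by exact_mod_cast hn
    have hn0 : (0 : ℝ) ≤ n := by positivity
    have hξX : X ≤ ξ := by linarith
    have hξ8 : ξ ≤ 8 * X := by linarith
    have hc : 0 < A * (γ * (1 - γ) * (2 - γ)) := by
      have := sub_pos.2 hγ1
      have : 0 < 2 - γ := by linarith
      positivity
    rw [hdiff, htA]
    constructor
    · exact mul_le_mul_of_nonneg_left
        (Real.rpow_le_rpow_of_nonpos (by linarith) hξ8 (by linarith)) hc.le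
    · have e : (8 : ℝ) ^ (3 - γ) * (A * (γ * (1 - γ) * (2 - γ)) * (8 * X) ^ (γ - 3)) =
          A * (γ * (1 - γ) * (2 - γ)) * X ^ (γ - 3) := by
        rw [Real.mul_rpow (by norm_num) hX.le]
        have : (8 : ℝ) ^ (3 - γ) * 8 ^ (γ - 3) = 1 := by
          rw [← Real.rpow_add (by norm_num)]
          simp
        linear_combination A * (γ * (1 - γ) * (2 - γ)) * X ^ (γ - 3) * this
      rw [e]
      exact mul_le_mul_of_nonneg_left
        (Real.rpow_le_rpow_of_nonpos hX hξX (by linarith)) hc.le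
  rw [hsum, Complex.norm_conj]
  refine (third_difference_test F K ht hH (fun n hn => (hbounds n hn).1)
    (fun n hn => (hbounds n hn).2)).trans ?_
  have hsK : √(K : ℝ) ≤ 2 * √X := by
    rw [Real.sqrt_le_left (by positivity), mul_pow, Real.sq_sqrt hX.le]
    linarith
  gcongr

/-- For `0 < γ < 1` the exponential sum over `N₁ / d < l ≤ N₂ / d` is bounded by a main term of
order `d ^ (-1/2)` and a secondary term of order `d ^ (-1)`. -/
lemma exists_norm_sum_dilated_le {γ : ℝ} (hγ0 : 0 < γ) (hγ1 : γ < 1) :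
    ∃ C > 0, ∀ (b M N₁ N₂ : ℝ) (d : ℕ), 0 < M → 0 < N₁ → N₁ ≤ N₂ → N₂ ≤ 2 * N₁ → 0 < d →
      ‖∑ l ∈ Ioc ⌊N₁ / (d : ℝ)⌋₊ ⌊N₂ / (d : ℝ)⌋₊,
        e2pi (b * (l : ℝ) ^ 2 - M * (d : ℝ) ^ γ * (l : ℝ) ^ γ)‖ ≤
      C * (M ^ ((1 : ℝ) / 6) * N₁ ^ (γ / 6 + 1 / 2) * (1 / √(d : ℝ)) +
        M ^ (-(1 : ℝ) / 6) * N₁ ^ (1 - γ / 6) * (1 / (d : ℝ))) := by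
  have h2γ : 0 < 2 - γ := by linarith
  have h1γ : 0 < 1 - γ := by linarith
  set κ : ℝ := γ * (1 - γ) * (2 - γ) * 8 ^ (γ - 3) with hκ
  have hκ0 : 0 < κ := by positivity
  set τ : ℝ := κ ^ ((1 : ℝ) / 6) with hτ
  have hτ0 : 0 < τ := by positivity
  have hτ6 : τ ^ 6 = κ := by
    rw [hτ, ← Real.rpow_natCast, ← Real.rpow_mul hκ0.le]
    norm_num
  refine ⟨20 * 8 ^ (3 - γ) * (3 * τ + 2 / τ), by positivity, ?_⟩
  intro b M N₁ N₂ d hM hN₁ h12 h21 hd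
  have hd0 : (0 : ℝ) < d := by exact_mod_cast hd
  set t : ℝ := τ * M ^ ((1 : ℝ) / 6) * √d * N₁ ^ ((γ - 3) / 6) with ht
  have ht0 : 0 < t := by positivity
  have ht6 : t ^ 6 = M * (d : ℝ) ^ γ * (γ * (1 - γ) * (2 - γ)) * (8 * (N₁ / d)) ^ (γ - 3) := by
    have e1 : (M ^ ((1 : ℝ) / 6)) ^ 6 = M := by
      rw [← Real.rpow_natCast, ← Real.rpow_mul hM.le]
      norm_num
    have e2 : (N₁ ^ ((γ - 3) / 6)) ^ 6 = N₁ ^ (γ - 3) := by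
      rw [← Real.rpow_natCast, ← Real.rpow_mul hN₁.le]
      congr 1
      push_cast
      ring
    have e3 : √(d : ℝ) ^ 6 = (d : ℝ) ^ 3 := by
      rw [show √(d : ℝ) ^ 6 = (√(d : ℝ) ^ 2) ^ 3 by ring, Real.sq_sqrt hd0.le]
    have e4 : (d : ℝ) ^ γ = (d : ℝ) ^ (γ - 3) * (d : ℝ) ^ 3 := by
      rw [← Real.rpow_natCast (d : ℝ) 3, ← Real.rpow_add hd0]
      congr 1
      push_cast
      ring
    rw [ht, mul_pow, mul_pow, mul_pow, hτ6, e1, e2, e3, Real.mul_rpow (by norm_num)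
      (by positivity), Real.div_rpow hN₁.le hd0.le, e4, hκ]
    field_simp
  have hmain := norm_sum_e2pi_quadratic_sub_rpow_le hγ0 hγ1 (A := M * (d : ℝ) ^ γ)
    (X := N₁ / d) (Y := N₂ / d) b (by positivity) (by positivity) (by gcongr)
    (by rw [← mul_div_assoc]; gcongr) ht0 ht6
  refine hmain.trans ?_
  have hsd : √(d : ℝ) * √(d : ℝ) = d := Real.mul_self_sqrt hd0.le
  have hsd0 : 0 < √(d : ℝ) := Real.sqrt_pos.2 hd0
  have hXt : N₁ / d * t = τ * (M ^ ((1 : ℝ) / 6) * N₁ ^ (γ / 6 + 1 / 2) * (1 / √(d : ℝ))) := by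
    have e : N₁ ^ (γ / 6 + 1 / 2) = N₁ * N₁ ^ ((γ - 3) / 6) := by
      rw [← Real.rpow_one_add' hN₁.le (by linarith)]
      congr 1
      ring
    rw [e, ht]
    nth_rewrite 1 [← hsd]
    field_simp
  have hXs : √(N₁ / d) / t =
      1 / τ * (M ^ (-(1 : ℝ) / 6) * N₁ ^ (1 - γ / 6) * (1 / (d : ℝ))) := by
    have e : N₁ ^ (1 - γ / 6) * N₁ ^ ((γ - 3) / 6) = √N₁ := by
      rw [← Real.rpow_add hN₁, Real.sqrt_eq_rpow]
      congr 1
      ring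
    have e' : M ^ (-(1 : ℝ) / 6) * M ^ ((1 : ℝ) / 6) = 1 := by
      rw [← Real.rpow_add hM]
      norm_num
    rw [div_eq_iff ht0.ne', Real.sqrt_div hN₁.le, ← e, ht]
    generalize M ^ (-(1 : ℝ) / 6) = u at *
    nth_rewrite 2 [← hsd]
    field_simp
    linear_combination -e'
  have hP : 0 ≤ M ^ ((1 : ℝ) / 6) * N₁ ^ (γ / 6 + 1 / 2) * (1 / √(d : ℝ)) := by positivity
  have hR : 0 ≤ M ^ (-(1 : ℝ) / 6) * N₁ ^ (1 - γ / 6) * (1 / (d : ℝ)) := by positivity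
  have hfac : 3 * (N₁ / d) * t + 2 * √(N₁ / d) / t =
      3 * (N₁ / d * t) + 2 * (√(N₁ / d) / t) := by ring
  rw [hfac, hXt, hXs, mul_assoc _ (3 * τ + 2 / τ)]
  refine mul_le_mul_of_nonneg_left ?_ (by positivity)
  have h1 := mul_nonneg (by positivity : 0 ≤ 2 / τ) hP
  have h2 := mul_nonneg (by positivity : 0 ≤ 3 * τ) hR
  have e : 2 / τ = 2 * (1 / τ) := by ring
  rw [e] at h1 ⊢
  linear_combination h1 + h2

lemma sum_one_div_le_one_add_log (D : ℕ) : ∑ d ∈ Icc 1 D, 1 / (d : ℝ) ≤ 1 + Real.log D := by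
  have h := harmonic_le_one_add_log D
  rw [harmonic_eq_sum_Icc] at h
  push_cast at h
  simpa using h

lemma log_mul_three_add_log_le {ε N : ℝ} (hε : 0 < ε) (hN : 1 ≤ N) :
    Real.log N * (3 + Real.log N) ≤ 2 / ε * (3 + 2 / ε) * N ^ ε := by
  have h1 := Real.log_le_rpow_div (x := N) (by linarith) (half_pos hε)
  have h2 : 1 ≤ N ^ (ε / 2) := Real.one_le_rpow hN (by positivity)
  have h3 : N ^ ε = N ^ (ε / 2) * N ^ (ε / 2) := by
    rw [← Real.rpow_add (by linarith)]
    congr 1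
    ring
  have h4 : N ^ (ε / 2) / (ε / 2) = 2 / ε * N ^ (ε / 2) := by field_simp
  rw [h4] at h1
  have h5 := Real.log_nonneg hN
  calc Real.log N * (3 + Real.log N)
      ≤ (2 / ε * N ^ (ε / 2)) * (3 * N ^ (ε / 2) + 2 / ε * N ^ (ε / 2)) := by
        gcongr
        linarith
    _ = _ := by rw [h3]; ring

lemma secondary_term_le {γ N N₁ M : ℝ} (hγ1 : 13 / 14 < γ) (hγ2 : γ < 1) (hN : 1 ≤ N)
    (hM : 1 ≤ M) (hN₁ : 0 < N₁) (hle : N₁ ≤ N) :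
    M ^ (-(1 : ℝ) / 6) * N₁ ^ (1 - γ / 6) ≤
      M ^ ((1 : ℝ) / 6) * N₁ ^ (γ / 6 + 1 / 2) * (N ^ ((2 * γ + 23) / 58)) ^ ((1 : ℝ) / 2) := by
  have h1 : M ^ (-(1 : ℝ) / 6) ≤ M ^ ((1 : ℝ) / 6) :=
    Real.rpow_le_rpow_of_exponent_le hM (by norm_num)
  have h2 : N₁ ^ (1 - γ / 6) = N₁ ^ (γ / 6 + 1 / 2) * N₁ ^ (1 / 2 - γ / 3) := by
    rw [← Real.rpow_add hN₁]
    congr 1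
    ring
  have h3 : N₁ ^ (1 / 2 - γ / 3) ≤ (N ^ ((2 * γ + 23) / 58)) ^ ((1 : ℝ) / 2) := by
    rw [← Real.rpow_mul (by linarith)]
    refine (Real.rpow_le_rpow hN₁.le hle (by linarith)).trans ?_
    exact Real.rpow_le_rpow_of_exponent_le hN (by linarith)
  rw [h2, mul_assoc (M ^ ((1 : ℝ) / 6))]
  gcongr

theorem Theta2_bound (γ ε : ℝ) (hγ1 : 13 / 14 < γ) (hγ2 : γ < 1) (hε : 0 < ε) :
    ∃ C > 0, ∀ (α : ℝ) (h : ℕ) (N : ℝ) (m : ℕ) (N₁ N₂ : ℝ) (c : ℕ → ℂ),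
      0 < h → 2 ≤ N → 0 < m → (m : ℝ) ≤ N ^ ((16 - 15 * γ) / 29) / 2 →
      N₁ < N₂ → N₂ ≤ 2 * N₁ → N₁ ≤ N / 2 →
      (∀ d : ℕ, ‖c d‖ ≤ Real.log d) →
      ‖∑ d ∈ Finset.Icc 1 ⌊N ^ ((2 * γ + 23) / 58)⌋₊, c d *
          ∑ l ∈ Finset.Ioc ⌊N₁ / (d : ℝ)⌋₊ ⌊N₂ / (d : ℝ)⌋₊,
            e2pi (α * (h : ℝ) * (d : ℝ) ^ 2 * (l : ℝ) ^ 2 -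
              (m : ℝ) * (d : ℝ) ^ γ * (l : ℝ) ^ γ)‖ ≤
      C * (m : ℝ) ^ ((1 : ℝ) / 6) * (N ^ ((2 * γ + 23) / 58)) ^ ((1 : ℝ) / 2) *
        N₁ ^ (γ / 6 + 1 / 2) * N ^ ε := by
  have hγ0 : 0 < γ := by linarith
  obtain ⟨C, hC, hdil⟩ := exists_norm_sum_dilated_le hγ0 hγ2
  refine ⟨C * (2 / ε * (3 + 2 / ε)), by positivity, ?_⟩
  intro α h N m N₁ N₂ c _ hN hm _ h12 h21 hN₁N hc
  have hN₁ : 0 < N₁ := by linarith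
  have hm1 : (1 : ℝ) ≤ m := by exact_mod_cast hm
  set ϑ := N ^ ((2 * γ + 23) / 58) with hϑ
  have hϑ0 : 0 ≤ ϑ := by positivity
  have hϑN : ϑ ≤ N := by
    have := Real.rpow_le_rpow_of_exponent_le (x := N) (by linarith)
      (by linarith : (2 * γ + 23) / 58 ≤ 1)
    rwa [Real.rpow_one] at this
  set D := ⌊ϑ⌋₊ with hD
  have hDϑ : (D : ℝ) ≤ ϑ := Nat.floor_le hϑ0
  set T := ϑ ^ ((1 : ℝ) / 2) with hT
  have hT0 : 0 ≤ T := by positivity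
  have hDT : √(D : ℝ) ≤ T := by
    rw [hT, ← Real.sqrt_eq_rpow]
    exact Real.sqrt_le_sqrt hDϑ
  set P := (m : ℝ) ^ ((1 : ℝ) / 6) * N₁ ^ (γ / 6 + 1 / 2) with hP
  have hP0 : 0 ≤ P := by positivity
  have hsec := secondary_term_le hγ1 hγ2 (by linarith : 1 ≤ N) hm1 hN₁ (by linarith)
  have hlogN : 0 ≤ Real.log N := Real.log_nonneg (by linarith)
  have hlog : ∀ d : ℕ, (d : ℝ) ≤ N → Real.log d ≤ Real.log N := by
    intro d hd
    rcases Nat.eq_zero_or_pos d with rfl | hd0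
    · simpa using hlogN
    · exact Real.log_le_log (by exact_mod_cast hd0) hd
  have hterm : ∀ d ∈ Icc 1 D, ‖c d * ∑ l ∈ Ioc ⌊N₁ / (d : ℝ)⌋₊ ⌊N₂ / (d : ℝ)⌋₊,
      e2pi (α * (h : ℝ) * (d : ℝ) ^ 2 * (l : ℝ) ^ 2 - (m : ℝ) * (d : ℝ) ^ γ * (l : ℝ) ^ γ)‖ ≤
      Real.log N * (C * (P * (1 / √(d : ℝ)) + P * T * (1 / (d : ℝ)))) := by
    intro d hd
    rw [mem_Icc] at hd
    have hdN : (d : ℝ) ≤ N := ((by exact_mod_cast hd.2 : (d : ℝ) ≤ D).trans hDϑ).trans hϑN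
    rw [norm_mul]
    refine mul_le_mul ((hc d).trans (hlog d hdN)) ?_ (norm_nonneg _) hlogN
    refine (hdil (α * h * (d : ℝ) ^ 2) m N₁ N₂ d (by linarith) hN₁ h12.le h21 (by omega)).trans ?_
    gcongr
  refine (norm_sum_le_of_le _ hterm).trans ?_
  rw [← mul_sum, ← mul_sum, sum_add_distrib, ← mul_sum, ← mul_sum]
  have hs1 := (sum_one_div_sqrt_le D).trans (by linarith : 2 * √(D : ℝ) ≤ 2 * T)
  have hs2 := (sum_one_div_le_one_add_log D).trans
    (by linarith [hlog D (hDϑ.trans hϑN)] : 1 + Real.log D ≤ 1 + Real.log N)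
  calc _ ≤ Real.log N * (C * (P * (2 * T) + P * T * (1 + Real.log N))) := by gcongr
    _ = C * P * T * (Real.log N * (3 + Real.log N)) := by ring
    _ ≤ C * P * T * (2 / ε * (3 + 2 / ε) * N ^ ε) := by
      exact mul_le_mul_of_nonneg_left (log_mul_three_add_log_le hε (by linarith)) (by positivity)
    _ = _ := by rw [hP]; ring
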